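/- Let ψ(q) = 1/q if q is prime and ψ(q) = 0 otherwise. Then ∫₀¹ (N(α;Q) − Ψ(Q))² dα = Ψ(Q) + O(1), with an absolute implied constant. -/

import Mathlib

open Filter MeasureTheory

/-- `Ψ(Q) = 2 ∑_{q ≤ Q} φ(q) ψ(q) / q`. -/
noncomputable def Psi (ψ : ℕ → ℝ) (Q : ℕ) : ℝ :=
  2 * ∑ q ∈ Finset.Icc 1 Q, (Nat.totient q : ℝ) * ψ q / q

/-- `N(α; Q)`: the number of pairs `(a, q) ∈ ℤ × ℕ` with `1 ≤ q ≤ Q`,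
`|α - a/q| < ψ(q)/q` and `gcd(a, q) = 1`. -/
noncomputable def Ncount (ψ : ℕ → ℝ) (α : ℝ) (Q : ℕ) : ℕ :=
  Nat.card {x : ℤ × ℕ | 1 ≤ x.2 ∧ x.2 ≤ Q ∧
    |α - (x.1 : ℝ) / (x.2 : ℝ)| < ψ x.2 / (x.2 : ℝ) ∧ Int.gcd x.1 (x.2 : ℤ) = 1}


noncomputable def VV (t y : ℝ) : ℝ := ((⌈y + t⌉ - ⌊y - t⌋ - 1 : ℤ) : ℝ)

lemma mem_Ioo_VV (t y : ℝ) (n : ℤ) : n ∈ Finset.Ioo ⌊y - t⌋ ⌈y + t⌉ ↔ |y - n| < t := by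
  rw [Finset.mem_Ioo, Int.floor_lt, Int.lt_ceil, abs_lt]
  constructor <;> rintro ⟨h1, h2⟩ <;> constructor <;> linarith

lemma VV_int_nonneg {t : ℝ} (ht : 0 < t) (y : ℝ) : 0 ≤ ⌈y + t⌉ - ⌊y - t⌋ - 1 := by
  have : ⌊y - t⌋ < ⌈y + t⌉ := by
    rw [Int.lt_ceil]; linarith [Int.floor_le (y - t)]
  omega

lemma card_VV {t : ℝ} (ht : 0 < t) (y : ℝ) :
    ((Finset.Ioo ⌊y - t⌋ ⌈y + t⌉).card : ℝ) = VV t y := by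
  have h := VV_int_nonneg ht y
  rw [Int.card_Ioo, VV, ← Int.cast_natCast, Int.toNat_of_nonneg]
  omega

lemma VV_nonneg {t : ℝ} (ht : 0 < t) (y : ℝ) : 0 ≤ VV t y := by
  have h := VV_int_nonneg ht y
  unfold VV; exact_mod_cast h

lemma VV_lt (t y : ℝ) : VV t y < 2 * t + 1 := by
  unfold VV; push_cast
  linarith [Int.ceil_lt_add_one (y + t), Int.lt_floor_add_one (y - t)]

lemma VV_le_one {t : ℝ} (ht : t ≤ 1 / 2) (y : ℝ) : VV t y ≤ 1 := by
  have h := VV_lt t y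
  unfold VV at *
  have : ((⌈y + t⌉ - ⌊y - t⌋ - 1 : ℤ) : ℝ) < (2 : ℤ) := by push_cast at *; linarith
  have := Int.cast_lt.1 this
  have : ⌈y + t⌉ - ⌊y - t⌋ - 1 ≤ 1 := by omega
  exact_mod_cast this

lemma VV_sq {t : ℝ} (ht : 0 < t) (ht' : t ≤ 1 / 2) (y : ℝ) : VV t y * VV t y = VV t y := by
  have h1 := VV_int_nonneg ht y
  have h2 := VV_le_one ht' y
  have h2 : ⌈y + t⌉ - ⌊y - t⌋ - 1 ≤ 1 := by unfold VV at h2; exact_mod_cast h2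
  unfold VV
  have : ⌈y + t⌉ - ⌊y - t⌋ - 1 = 0 ∨ ⌈y + t⌉ - ⌊y - t⌋ - 1 = 1 := by omega
  rcases this with h | h <;> rw [h] <;> simp

lemma VV_add_int (t y : ℝ) (n : ℤ) : VV t (y + n) = VV t y := by
  unfold VV
  rw [show y + n + t = (y + t) + n by ring, show y + n - t = (y - t) + n by ring,
    Int.ceil_add_intCast, Int.floor_add_intCast]
  congr 1; ring

lemma VV_periodic (t : ℝ) : Function.Periodic (VV t) 1 := by
  intro y; simpa using VV_add_int t y 1

def Nice (f : ℝ → ℝ) : Prop := Measurable f ∧ ∃ C, ∀ x, |f x| ≤ C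

lemma Nice.mul {f g : ℝ → ℝ} (hf : Nice f) (hg : Nice g) : Nice (fun x => f x * g x) := by
  obtain ⟨hf, C, hC⟩ := hf
  obtain ⟨hg, D, hD⟩ := hg
  refine ⟨hf.mul hg, C * D, fun x => ?_⟩
  rw [abs_mul]
  exact mul_le_mul (hC x) (hD x) (abs_nonneg _) ((abs_nonneg _).trans (hC x))

lemma Nice.sub {f g : ℝ → ℝ} (hf : Nice f) (hg : Nice g) : Nice (fun x => f x - g x) := by
  obtain ⟨hf, C, hC⟩ := hf
  obtain ⟨hg, D, hD⟩ := hg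
  refine ⟨hf.sub hg, C + D, fun x => ?_⟩
  exact (abs_sub _ _).trans (add_le_add (hC x) (hD x))

lemma Nice.const (c : ℝ) : Nice (fun _ => c) := ⟨measurable_const, |c|, fun _ => le_rfl⟩

lemma Nice.comp {f g : ℝ → ℝ} (hf : Nice f) (hg : Measurable g) : Nice (fun x => f (g x)) :=
  ⟨hf.1.comp hg, hf.2.choose, fun x => hf.2.choose_spec (g x)⟩

lemma Nice.ii {f : ℝ → ℝ} (hf : Nice f) (a b : ℝ) : IntervalIntegrable f volume a b := by
  obtain ⟨hf, C, hC⟩ := hf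
  refine (intervalIntegrable_const (c := C)).mono_fun hf.aestronglyMeasurable ?_
  refine Filter.Eventually.of_forall fun x => ?_
  simpa using (hC x).trans (le_abs_self C)

lemma Nice.VV {t : ℝ} (ht : 0 < t) : Nice (VV t) := by
  refine ⟨?_, 2 * t + 1, fun x => ?_⟩
  · unfold _root_.VV
    push_cast
    have h1 : Measurable (fun y : ℝ => ((⌈y + t⌉ : ℤ) : ℝ)) :=
      (measurable_from_top (f := fun n : ℤ => (n : ℝ))).comp
        (Int.measurable_ceil.comp (measurable_id.add_const t))
    have h2 : Measurable (fun y : ℝ => ((⌊y - t⌋ : ℤ) : ℝ)) :=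
      (measurable_from_top (f := fun n : ℤ => (n : ℝ))).comp
        (Int.measurable_floor.comp (measurable_id.sub_const t))
    exact (h1.sub h2).sub_const 1
  · rw [abs_of_nonneg (VV_nonneg ht x)]; exact (VV_lt t x).le

lemma Nice.VVl {t : ℝ} (ht : 0 < t) (c : ℝ) : Nice (fun x => _root_.VV t (c * x)) :=
  (Nice.VV ht).comp (measurable_const_mul c)

/-- unfolding -/
lemma unfold_VV {s : ℝ} (hs : 0 < s) (hs' : s ≤ 1 / 2) {H : ℝ → ℝ} (hH : Nice H)
    (hp : Function.Periodic H 1) : ∫ x in (0:ℝ)..1, VV s x * H x = ∫ x in (-s)..s, H x := by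
  have hn := (Nice.VV hs).mul hH
  have hper : Function.Periodic (fun x => VV s x * H x) 1 := (VV_periodic s).mul hp
  have e1 := hper.intervalIntegral_add_eq 0 (-(1/2))
  rw [zero_add, show -(1/2:ℝ) + 1 = 1/2 by norm_num] at e1
  rw [e1, ← intervalIntegral.integral_add_adjacent_intervals (hn.ii _ (-s)) (hn.ii (-s) _),
    ← intervalIntegral.integral_add_adjacent_intervals (hn.ii (-s) s) (hn.ii s _)]
  have z1 : ∫ x in (-(1/2))..(-s), VV s x * H x = 0 := by
    apply intervalIntegral.integral_zero_ae
    refine Filter.Eventually.of_forall fun x hx => ?_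
    rw [Set.uIoc_of_le (by linarith)] at hx
    have h1 : ⌈x + s⌉ = 0 := by rw [Int.ceil_eq_iff]; push_cast; constructor <;> linarith [hx.1, hx.2]
    have h2 : ⌊x - s⌋ = -1 := by rw [Int.floor_eq_iff]; push_cast; constructor <;> linarith [hx.1, hx.2]
    simp [VV, h1, h2]
  have z2 : ∫ x in s..(1/2), VV s x * H x = 0 := by
    rw [intervalIntegral.integral_of_le hs', integral_Ioc_eq_integral_Ioo]
    apply setIntegral_eq_zero_of_forall_eq_zero
    intro x hx
    have h1 : ⌈x + s⌉ = 1 := by rw [Int.ceil_eq_iff]; push_cast; constructor <;> linarith [hx.1, hx.2]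
    have h2 : ⌊x - s⌋ = 0 := by rw [Int.floor_eq_iff]; push_cast; constructor <;> linarith [hx.1, hx.2]
    simp [VV, h1, h2]
  have z3 : ∫ x in (-s)..s, VV s x * H x = ∫ x in (-s)..s, H x := by
    rw [intervalIntegral.integral_of_le (by linarith), intervalIntegral.integral_of_le (by linarith),
      integral_Ioc_eq_integral_Ioo, integral_Ioc_eq_integral_Ioo]
    apply setIntegral_congr_fun measurableSet_Ioo
    intro x hx
    have h1 : ⌈x + s⌉ = 1 := by rw [Int.ceil_eq_iff]; push_cast; constructor <;> linarith [hx.1, hx.2]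
    have h2 : ⌊x - s⌋ = -1 := by rw [Int.floor_eq_iff]; push_cast; constructor <;> linarith [hx.1, hx.2]
    simp [VV, h1, h2]
  rw [z1, z2, z3]; ring

lemma int_fract (c : ℝ) : ∫ x in (0:ℝ)..1, Int.fract (x + c) = 1/2 := by
  rw [intervalIntegral.integral_comp_add_right (fun x => Int.fract x)]
  have hp : Function.Periodic (fun x : ℝ => Int.fract x) 1 := fun x => by simp
  have := hp.intervalIntegral_add_eq c 0
  rw [zero_add, add_comm] at *
  rw [add_comm, this]
  rw [intervalIntegral.integral_of_le (by norm_num), integral_Ioc_eq_integral_Ioo]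
  rw [setIntegral_congr_fun (g := fun x => x) measurableSet_Ioo]
  · rw [← integral_Ioc_eq_integral_Ioo, ← intervalIntegral.integral_of_le (by norm_num)]
    simp
  · intro x hx
    exact Int.fract_eq_self.2 ⟨hx.1.le, hx.2⟩

lemma Nice.fract : Nice (fun x => Int.fract x) :=
  ⟨measurable_fract, 1, fun x => by
    rw [abs_of_nonneg (Int.fract_nonneg x)]; exact (Int.fract_lt_one x).le⟩

lemma int_VV (t : ℝ) : ∫ x in (0:ℝ)..1, VV t x = 2 * t := by
  have e : ∀ x, VV t x = (2 * t - 1) + (Int.fract (-t - x) + Int.fract (x + (-t))) := by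
    intro x
    unfold VV Int.fract; push_cast
    rw [show x + t = -(-t - x) by ring, Int.ceil_neg, ← sub_eq_add_neg]
    push_cast; ring
  have i1 : IntervalIntegrable (fun x => Int.fract (-t - x)) volume 0 1 :=
    (Nice.fract.comp (measurable_const.sub measurable_id)).ii _ _
  have i2 : IntervalIntegrable (fun x => Int.fract (x + (-t))) volume 0 1 :=
    (Nice.fract.comp (measurable_id.add_const _)).ii _ _
  simp_rw [e]
  rw [intervalIntegral.integral_add (by simp) (i1.add i2), intervalIntegral.integral_add i1 i2,
    int_fract]
  have : ∫ x in (0:ℝ)..1, Int.fract (-t - x) = 1/2 := by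
    rw [← int_fract (-t-1), intervalIntegral.integral_comp_sub_left (fun x => Int.fract x),
      intervalIntegral.integral_comp_add_right (fun x => Int.fract x)]
    congr 1 <;> ring
  rw [this]; simp; ring

lemma avg_VV {t : ℝ} (ht : 0 < t) {T : ℝ} (hT : 0 < T) :
    |(∫ x in (-T)..T, VV t x) - 4 * T * t| ≤ 2 * t := by
  have hn := Nice.VV ht
  have key : ∀ n : ℤ, ∫ x in (-T)..(-T + n), VV t x = n * (2 * t) := by
    intro n
    have := (VV_periodic t).intervalIntegral_add_zsmul_eq n (-T) (fun a b => hn.ii a b)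
    rw [(VV_periodic t).intervalIntegral_add_eq (-T) 0, zero_add, int_VV] at this
    simpa using this
  have h1 := Int.floor_le (2 * T)
  have h2 := Int.lt_floor_add_one (2 * T)
  have h0 : (0:ℝ) ≤ ⌊2 * T⌋ := by
    have : 0 ≤ ⌊2 * T⌋ := Int.floor_nonneg.2 (by linarith)
    exact_mod_cast this
  have k1 := key ⌊2 * T⌋
  have k2 := key (⌊2 * T⌋ + 1)
  push_cast at k2
  rw [← intervalIntegral.integral_add_adjacent_intervals (hn.ii _ T) (hn.ii T _)] at k2
  have m2 : 0 ≤ ∫ x in T..(-T + (⌊2 * T⌋ + 1)), VV t x :=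
    intervalIntegral.integral_nonneg (by linarith) (fun x _ => VV_nonneg ht x)
  have m1 : 0 ≤ ∫ x in (-T + ⌊2 * T⌋)..T, VV t x :=
    intervalIntegral.integral_nonneg (by linarith) (fun x _ => VV_nonneg ht x)
  have e1 := intervalIntegral.integral_add_adjacent_intervals (hn.ii (-T) (-T + ⌊2 * T⌋)) (hn.ii (-T + ⌊2 * T⌋) T)
  rw [abs_le]
  constructor <;> nlinarith

lemma corr1 {s t : ℝ} (hs : 0 < s) (hs' : s ≤ 1/2) (ht : 0 < t) {r : ℕ} (hr : 0 < r) :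
    |(∫ x in (0:ℝ)..1, VV s x * VV t (r * x)) - 4 * s * t| ≤ 2 * t / r := by
  have hr' : (0:ℝ) < r := by exact_mod_cast hr
  have hper : Function.Periodic (fun x => VV t (r * x)) 1 := by
    intro x
    have := VV_add_int t (r * x) r
    simp only [mul_add, mul_one]
    simpa using this
  rw [unfold_VV hs hs' (Nice.VVl ht r) hper, intervalIntegral.integral_comp_mul_left _ hr'.ne']
  have := avg_VV ht (mul_pos hr' hs)
  rw [smul_eq_mul, mul_neg, le_div_iff₀ hr']
  calc _ = |((r:ℝ)⁻¹ * (∫ x in (-(r * s))..(r * s), VV t x) - 4 * s * t) * r| := by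
        rw [abs_mul, abs_of_pos hr']
    _ = |(∫ x in (-(r * s))..(r * s), VV t x) - 4 * (r * s) * t| := by
        congr 1; field_simp
    _ ≤ _ := this

lemma hermite_int (n : ℕ) (hn : 0 < n) (k : ℤ) :
    ∑ j ∈ Finset.range n, (k + (j:ℤ)) / (n:ℤ) = k := by
  have step : ∀ k : ℤ, ∑ j ∈ Finset.range n, (k + 1 + (j:ℤ)) / (n:ℤ)
      = ∑ j ∈ Finset.range n, (k + (j:ℤ)) / (n:ℤ) + 1 := by
    intro k
    have h1 := Finset.sum_range_succ (fun j : ℕ => (k + (j:ℤ)) / (n:ℤ)) n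
    have h2 := Finset.sum_range_succ' (fun j : ℕ => (k + (j:ℤ)) / (n:ℤ)) n
    have h3 : (k + (n:ℤ)) / (n:ℤ) = k / n + 1 := by
      rw [Int.add_ediv_of_dvd_right (dvd_refl _), Int.ediv_self (by omega)]
    have h4 : ∑ j ∈ Finset.range n, (k + 1 + (j:ℤ)) / (n:ℤ)
      = ∑ j ∈ Finset.range n, (k + ((j+1 : ℕ):ℤ)) / (n:ℤ) := by
      refine Finset.sum_congr rfl fun j _ => ?_
      push_cast; congr 1; ring
    simp only [h3] at h1
    simp only [Nat.cast_zero, add_zero] at h2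
    rw [h4]; linarith
  induction k using Int.induction_on with
  | zero =>
    refine Finset.sum_eq_zero fun j hj => ?_
    rw [zero_add]
    exact Int.ediv_eq_zero_of_lt (by omega) (by have := Finset.mem_range.1 hj; omega)
  | succ k ih => rw [step, ih]
  | pred k ih =>
    have := step (-(k:ℤ) - 1)
    rw [sub_add_cancel, ih] at this
    linarith

lemma hermite (n : ℕ) (hn : 0 < n) (x : ℝ) :
    ∑ j ∈ Finset.range n, ⌊x + j / n⌋ = ⌊n * x⌋ := by
  rw [← hermite_int n hn ⌊n * x⌋]
  refine Finset.sum_congr rfl fun j _ => ?_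
  have hn' : (n:ℝ) ≠ 0 := by positivity
  have : x + j / n = (n * x + (j:ℤ)) / n := by field_simp; push_cast; ring
  rw [this, Int.floor_div_natCast, Int.floor_add_intCast]

lemma hermite_ceil (n : ℕ) (hn : 0 < n) (x : ℝ) :
    ∑ j ∈ Finset.range n, ⌈x + j / n⌉ = ⌈n * x⌉ + n - 1 := by
  have hn' : (n:ℝ) ≠ 0 := by positivity
  have h := hermite n hn (-x - (n - 1) / n)
  rw [← Finset.sum_range_reflect] at h
  have e : n * (-x - (n - 1) / n : ℝ) = -(n * x) - ((n:ℤ) - 1 : ℤ) := by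
    push_cast; field_simp
  rw [e, Int.floor_sub_intCast, Int.floor_neg] at h
  have : ∑ j ∈ Finset.range n, ⌈x + j / n⌉ =
      - ∑ j ∈ Finset.range n, ⌊-x - ((n:ℝ) - 1) / n + ((n - 1 - j : ℕ) : ℝ) / n⌋ := by
    rw [← Finset.sum_neg_distrib]
    refine Finset.sum_congr rfl fun j hj => ?_
    have := Finset.mem_range.1 hj
    rw [← Int.ceil_neg]
    congr 1
    rw [Nat.cast_sub (by omega), Nat.cast_sub (by omega)]
    push_cast; field_simp; ring
  rw [this, h]; ring

lemma perm_sum (p r : ℕ) (hp : 0 < p) (hpr : Nat.Coprime p r) (h : ℕ → ℝ) :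
    ∑ j ∈ Finset.range p, h (r * j % p) = ∑ j ∈ Finset.range p, h j := by
  have hinj : Set.InjOn (fun j => r * j % p) (Finset.range p : Set ℕ) := by
    intro a ha b hb hab
    have h1 : r * a ≡ r * b [MOD p] := hab
    have h2 := Nat.ModEq.cancel_left_of_coprime hpr h1
    rw [Finset.coe_range] at ha hb
    exact Nat.ModEq.eq_of_lt_of_lt h2 ha hb
  have himg : (Finset.range p).image (fun j => r * j % p) = Finset.range p := by
    apply Finset.eq_of_subset_of_card_le
    · intro x hx
      obtain ⟨j, _, rfl⟩ := Finset.mem_image.1 hx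
      exact Finset.mem_range.2 (Nat.mod_lt _ hp)
    · rw [Finset.card_image_of_injOn hinj]
  conv_rhs => rw [← himg]
  rw [Finset.sum_image hinj]

lemma pi_pow (k : ℕ) (hk : 0 < k) : (Nat.primeCounting (2 ^ k) : ℝ) ≤ 6 * 2 ^ k / k := by
  have hk' : (0:ℝ) < k := by exact_mod_cast hk
  have h := Chebyshev.pi_le_log4_mul_div (x := (2:ℝ)^k) (one_lt_pow₀ (by norm_num) hk.ne')
  have hf : ⌊(2:ℝ)^k⌋₊ = 2 ^ k := by
    have : (2:ℝ)^k = ((2^k : ℕ) : ℝ) := by push_cast; rfl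
    rw [this, Nat.floor_natCast]
  rw [hf] at h
  refine h.trans ?_
  have l2 : 0 < Real.log 2 := Real.log_pos (by norm_num)
  have l4 : Real.log 4 = 2 * Real.log 2 := by
    rw [show (4:ℝ) = 2^2 by norm_num, Real.log_pow]; norm_num
  rw [Real.log_sqrt (by positivity), Real.log_pow, l4]
  have e : 2 * Real.log 2 * 2 ^ k / (k * Real.log 2 / 2) = 4 * 2 ^ k / k := by
    field_simp; norm_num
  rw [e]
  have q : ∀ k : ℕ, k ^ 2 ≤ 4 * 2 ^ k := by
    intro k
    induction k with
    | zero => simp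
    | succ n ih =>
      by_cases hn : n ≤ 3
      · interval_cases n <;> norm_num
      · have : (n+1)^2 ≤ 2 * n^2 := by nlinarith
        rw [pow_succ 2]; omega
  have q' : (k:ℝ)^2 ≤ 4 * 2^k := by exact_mod_cast q k
  have hs : Real.sqrt (2^k) * Real.sqrt (2^k) = (2:ℝ)^k := Real.mul_self_sqrt (by positivity)
  have hs0 : 0 ≤ Real.sqrt ((2:ℝ)^k) := Real.sqrt_nonneg _
  have : (k:ℝ) ≤ 2 * Real.sqrt (2^k) := by
    apply le_of_sq_le_sq _ (by positivity)
    nlinarith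
  have : Real.sqrt (2^k) ≤ 2 * 2^k / k := by
    rw [le_div_iff₀ hk']; nlinarith
  calc _ ≤ 4 * 2 ^ k / (k:ℝ) + 2 * 2^k / k := by linarith
    _ = _ := by ring

lemma prime_sum_bdd : ∃ K : ℝ, 0 ≤ K ∧ ∀ Q : ℕ,
    ∑ p ∈ (Finset.Icc 1 Q).filter Nat.Prime, (Nat.primeCounting p : ℝ) / (p:ℝ)^2 ≤ K := by
  have hsum : Summable (fun j : ℕ => 144 * (1 / ((j + 1 : ℕ) : ℝ)^2)) :=
    ((summable_nat_add_iff 1).2 (Real.summable_one_div_nat_pow.2 (by norm_num : 1 < 2))).mul_left _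
  refine ⟨∑' j : ℕ, 144 * (1 / ((j + 1 : ℕ) : ℝ)^2), tsum_nonneg fun j => by positivity, fun Q => ?_⟩
  refine le_trans ?_ (hsum.sum_le_tsum (Finset.range (Q+1)) fun j _ => by positivity)
  rw [← Finset.sum_fiberwise_of_maps_to (s := (Finset.Icc 1 Q).filter Nat.Prime)
    (t := Finset.range (Q+1)) (g := Nat.log 2)]
  · refine Finset.sum_le_sum fun j _ => ?_
    have hb := pi_pow (j+1) (by omega)
    set P : ℝ := (Nat.primeCounting (2 ^ (j+1)) : ℝ) with hP
    have hP0 : 0 ≤ P := Nat.cast_nonneg _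
    have hcard : ((((Finset.Icc 1 Q).filter Nat.Prime).filter (fun p => Nat.log 2 p = j)).card : ℝ) ≤ P := by
      rw [hP, ← Nat.primesLE_card_eq_primeCounting]
      norm_cast
      apply Finset.card_le_card
      intro p hp
      simp only [Finset.mem_filter, Finset.mem_Icc] at hp
      rw [Nat.mem_primesLE]
      refine ⟨?_, hp.1.2⟩
      rw [← hp.2]
      exact (Nat.lt_pow_succ_log_self (by norm_num) p).le
    have hterm : ∀ p ∈ ((Finset.Icc 1 Q).filter Nat.Prime).filter (fun p => Nat.log 2 p = j),
        (Nat.primeCounting p : ℝ) / (p:ℝ)^2 ≤ P / (2^j)^2 := by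
      intro p hp
      simp only [Finset.mem_filter, Finset.mem_Icc] at hp
      have h1 : p ≤ 2^(j+1) := by
        rw [← hp.2]; exact (Nat.lt_pow_succ_log_self (by norm_num) p).le
      have h2 : 2^j ≤ p := by
        rw [← hp.2]; exact Nat.pow_log_le_self 2 (by omega)
      have h2' : (2:ℝ)^j ≤ p := by exact_mod_cast h2
      have h3 : (Nat.primeCounting p : ℝ) ≤ P := by
        rw [hP]; exact_mod_cast Nat.monotone_primeCounting h1
      gcongr
    refine (Finset.sum_le_card_nsmul _ _ _ hterm).trans ?_
    rw [nsmul_eq_mul]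
    calc _ ≤ P * (P / (2^j)^2) := by gcongr
      _ = P * P / (2^j)^2 := by ring
      _ ≤ (6 * 2^(j+1) / ((j+1:ℕ):ℝ)) * (6 * 2^(j+1) / ((j+1:ℕ):ℝ)) / (2^j)^2 := by gcongr
      _ = _ := by
        rw [pow_succ]; field_simp; norm_num
  · intro p hp
    simp only [Finset.mem_filter, Finset.mem_Icc] at hp
    rw [Finset.mem_range]
    exact lt_of_le_of_lt (Nat.log_le_self 2 p) (by omega)

lemma sum_VV (n : ℕ) (hn : 0 < n) (t x : ℝ) :
    ∑ j ∈ Finset.range n, VV t (x + j / n) = VV (n * t) (n * x) := by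
  unfold VV
  rw [← Int.cast_sum]
  congr 1
  rw [Finset.sum_sub_distrib, Finset.sum_sub_distrib]
  have h1 := hermite_ceil n hn (x + t)
  have h2 := hermite n hn (x - t)
  have e1 : ∑ j ∈ Finset.range n, ⌈x + j / n + t⌉ = ∑ j ∈ Finset.range n, ⌈x + t + j / n⌉ :=
    Finset.sum_congr rfl fun j _ => by rw [add_right_comm]
  have e2 : ∑ j ∈ Finset.range n, ⌊x + j / n - t⌋ = ∑ j ∈ Finset.range n, ⌊x - t + j / n⌋ :=
    Finset.sum_congr rfl fun j _ => by congr 1; ring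
  rw [e1, e2, h1, h2, mul_add, mul_sub]
  simp
  ring

lemma corr2 {s t : ℝ} (hs : 0 < s) (ht : 0 < t) {p r : ℕ} (hp : 0 < p) (hpr : Nat.Coprime p r) :
    (p:ℝ) * ∫ x in (0:ℝ)..1, VV s (p * x) * VV t (r * x)
      = ∫ x in (0:ℝ)..1, VV s x * VV (p * t) (r * x) := by
  have hp' : (0:ℝ) < p := by exact_mod_cast hp
  set F : ℝ → ℝ := fun x => VV s (p * x) * VV t (r * x) with hF
  have hper : Function.Periodic F 1 := by
    intro x
    have h1 := VV_add_int s (p * x) p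
    have h2 := VV_add_int t (r * x) r
    simp only [hF, mul_add, mul_one]
    simp only [Int.cast_natCast] at h1 h2
    rw [h1, h2]
  have hj : ∀ j ∈ Finset.range p, ∫ x in (0:ℝ)..1, F x
      = ∫ x in (0:ℝ)..1, VV s (p * x) * VV t (r * x + ((r * j % p : ℕ):ℝ) / p) := by
    intro j _
    have h1 := hper.intervalIntegral_add_eq 0 ((j:ℝ)/p)
    rw [zero_add, add_comm] at h1
    rw [h1]
    have h2 := intervalIntegral.integral_comp_add_right (a := 0) (b := 1) F ((j:ℝ)/p)
    rw [zero_add] at h2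
    rw [← h2]
    refine intervalIntegral.integral_congr fun x _ => ?_
    have e1 := VV_add_int s (p * x) j
    have e2 := VV_add_int t (r * x + ((r * j % p : ℕ):ℝ) / p) ((r * j / p : ℕ) : ℤ)
    simp only [hF]
    rw [← e1, ← e2]
    congr 2
    · push_cast; field_simp
    · have : ((r * j % p : ℕ):ℝ) + p * ((r * j / p : ℕ):ℝ) = r * j := by
        exact_mod_cast Nat.mod_add_div (r * j) p
      rw [Int.cast_natCast]
      field_simp
      linarith
  have h1 : (p:ℝ) * ∫ x in (0:ℝ)..1, F x = ∑ j ∈ Finset.range p,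
      ∫ x in (0:ℝ)..1, VV s (p * x) * VV t (r * x + ((r * j % p : ℕ):ℝ) / p) := by
    rw [← Finset.sum_congr rfl hj]; simp
  rw [h1, ← intervalIntegral.integral_finsetSum]
  swap
  · intro j _
    exact ((Nice.VVl hs p).mul ((Nice.VV ht).comp ((measurable_const_mul _).add_const _))).ii _ _
  set K : ℝ → ℝ := fun x => VV s x * VV (p * t) (r * x) with hK
  have hKn : Nice K := (Nice.VV hs).mul (Nice.VVl (mul_pos hp' ht) r)
  have hKper : Function.Periodic K 1 := by
    intro x
    have h1 := VV_add_int s x 1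
    have h2 := VV_add_int (p * t) (r * x) r
    simp only [hK, mul_add, mul_one]
    simp only [Int.cast_natCast, Int.cast_one] at h1 h2
    rw [h1, h2]
  have h2 : ∀ x, ∑ j ∈ Finset.range p, VV s (p * x) * VV t (r * x + ((r * j % p : ℕ):ℝ) / p)
      = K (p * x) := by
    intro x
    rw [← Finset.mul_sum, perm_sum p r hp hpr (fun j => VV t (r * x + (j:ℝ) / p)), sum_VV p hp]
    simp only [hK]
    congr 2; ring
  simp_rw [h2]
  rw [intervalIntegral.integral_comp_mul_left _ hp'.ne']
  have h3 := hKper.intervalIntegral_add_zsmul_eq p 0 (fun a b => hKn.ii a b)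
  simp only [zero_add, zsmul_eq_mul, mul_one, Int.cast_natCast] at h3
  rw [mul_zero, mul_one, h3, smul_eq_mul, inv_mul_cancel_left₀ hp'.ne']

lemma int_VVl (t : ℝ) (ht : 0 < t) (p : ℕ) (hp : 0 < p) :
    ∫ x in (0:ℝ)..1, VV t (p * x) = 2 * t := by
  have hp' : (0:ℝ) < p := by exact_mod_cast hp
  rw [intervalIntegral.integral_comp_mul_left _ hp'.ne']
  have h3 := (VV_periodic t).intervalIntegral_add_zsmul_eq p 0 (fun a b => (Nice.VV ht).ii a b)
  simp only [zero_add, zsmul_eq_mul, mul_one, Int.cast_natCast] at h3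
  rw [mul_zero, mul_one, h3, smul_eq_mul, inv_mul_cancel_left₀ hp'.ne', int_VV]

noncomputable def fA (p : ℕ) (x : ℝ) : ℝ := VV (1 / p) (p * x)
noncomputable def fB (p : ℕ) (x : ℝ) : ℝ := VV (1 / (p:ℝ)^2) x
noncomputable def mm (p : ℕ) : ℝ := 2 / p - 2 / (p:ℝ)^2
noncomputable def gg (p : ℕ) (x : ℝ) : ℝ := fA p x - fB p x - mm p

section
variable {p r : ℕ}

lemma pos1 (hp : 2 ≤ p) : (0:ℝ) < 1 / p := by positivity
lemma pos2 (hp : 2 ≤ p) : (0:ℝ) < 1 / (p:ℝ)^2 := by positivity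
lemma half1 (hp : 2 ≤ p) : (1:ℝ) / p ≤ 1 / 2 := by
  have : (2:ℝ) ≤ p := by exact_mod_cast hp
  gcongr
lemma half2 (hp : 2 ≤ p) : (1:ℝ) / (p:ℝ)^2 ≤ 1 / 2 := by
  have : (2:ℝ) ≤ p := by exact_mod_cast hp
  have : (2:ℝ) ≤ (p:ℝ)^2 := by nlinarith
  gcongr

lemma niceA (hp : 2 ≤ p) : Nice (fA p) := Nice.VVl (pos1 hp) p
lemma niceB (hp : 2 ≤ p) : Nice (fB p) := Nice.VV (pos2 hp)
lemma niceG (hp : 2 ≤ p) : Nice (gg p) := ((niceA hp).sub (niceB hp)).sub (Nice.const _)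

lemma intA (hp : 2 ≤ p) : ∫ x in (0:ℝ)..1, fA p x = 2 / p := by
  unfold fA; rw [int_VVl _ (pos1 hp) p (by omega)]; ring
lemma intB : ∫ x in (0:ℝ)..1, fB p x = 2 / (p:ℝ)^2 := by
  unfold fB
  rw [int_VV]; ring

lemma mulB_bound (hr : 2 ≤ r) {f : ℝ → ℝ} (hf : Nice f) (h0 : ∀ x, 0 ≤ f x) (h1 : ∀ x, f x ≤ 1) :
    0 ≤ (∫ x in (0:ℝ)..1, f x * fB r x) ∧ (∫ x in (0:ℝ)..1, f x * fB r x) ≤ 2 / (r:ℝ)^2 := by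
  have hB : ∀ x, 0 ≤ fB r x := fun x => VV_nonneg (pos2 hr) x
  constructor
  · exact intervalIntegral.integral_nonneg (by norm_num) fun x _ => mul_nonneg (h0 x) (hB x)
  · rw [← intB]
    refine intervalIntegral.integral_mono_on (by norm_num) ((hf.mul (niceB hr)).ii _ _)
      ((niceB hr).ii _ _) fun x _ => ?_
    nlinarith [hB x, h1 x]

lemma int_gg (hp : 2 ≤ p) (hr : 2 ≤ r) : ∫ x in (0:ℝ)..1, gg p x * gg r x =
    (∫ x in (0:ℝ)..1, fA p x * fA r x) - (∫ x in (0:ℝ)..1, fA p x * fB r x)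
    - (∫ x in (0:ℝ)..1, fB p x * fA r x) + (∫ x in (0:ℝ)..1, fB p x * fB r x) - mm p * mm r := by
  have e : ∀ x, gg p x * gg r x = (fA p x * fA r x - fA p x * fB r x - fB p x * fA r x
     + fB p x * fB r x) - (mm p * (fA r x - fB r x) + mm r * (fA p x - fB p x) - mm p * mm r) := by
    intro x; unfold gg; ring
  simp_rw [e]
  have a1 := ((niceA hp).mul (niceA hr)).ii 0 1
  have a2 := ((niceA hp).mul (niceB hr)).ii 0 1
  have a3 := ((niceB hp).mul (niceA hr)).ii 0 1
  have a4 := ((niceB hp).mul (niceB hr)).ii 0 1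
  have b1 := (niceA hp).ii 0 1
  have b2 := (niceA hr).ii 0 1
  have b3 := (niceB hp).ii 0 1
  have b4 := (niceB hr).ii 0 1
  have c1 := (b2.sub b4).const_mul (mm p)
  have c2 := (b1.sub b3).const_mul (mm r)
  rw [intervalIntegral.integral_sub (((a1.sub a2).sub a3).add a4)
      ((c1.add c2).sub intervalIntegrable_const),
    intervalIntegral.integral_add ((a1.sub a2).sub a3) a4,
    intervalIntegral.integral_sub (a1.sub a2) a3, intervalIntegral.integral_sub a1 a2,
    intervalIntegral.integral_sub (c1.add c2) intervalIntegrable_const,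
    intervalIntegral.integral_add c1 c2, intervalIntegral.integral_const_mul,
    intervalIntegral.integral_const_mul, intervalIntegral.integral_sub b2 b4,
    intervalIntegral.integral_sub b1 b3, intA hp, intA hr, intB, intB]
  simp only [intervalIntegral.integral_const, smul_eq_mul]
  unfold mm; ring

lemma cov_lt (hp : 2 ≤ p) (hr : 2 ≤ r) (hpr : Nat.Coprime p r) :
    |∫ x in (0:ℝ)..1, gg p x * gg r x| ≤ 16 / (r:ℝ)^2 := by
  have hp' : (2:ℝ) ≤ p := by exact_mod_cast hp
  have hr' : (2:ℝ) ≤ r := by exact_mod_cast hr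
  have hr0 : (0:ℝ) < r := by linarith
  have hp0 : (0:ℝ) < p := by linarith
  rw [int_gg hp hr]
  have AB := mulB_bound hr (niceA hp) (fun x => VV_nonneg (pos1 hp) _) (fun x => VV_le_one (half1 hp) _)
  have BB := mulB_bound hr (niceB hp) (fun x => VV_nonneg (pos2 hp) _) (fun x => VV_le_one (half2 hp) _)
  have BA := corr1 (pos2 hp) (half2 hp) (pos1 hr) (r := r) (by omega)
  have AA := corr1 (pos1 hp) (half1 hp) (mul_pos hp0 (pos1 hr)) (r := r) (by omega)
  rw [← corr2 (pos1 hp) (pos1 hr) (by omega) hpr] at AA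
  change |(p:ℝ) * (∫ x in (0:ℝ)..1, fA p x * fA r x) - _| ≤ _ at AA
  change |(∫ x in (0:ℝ)..1, fB p x * fA r x) - _| ≤ _ at BA
  set iAA := ∫ x in (0:ℝ)..1, fA p x * fA r x
  set iBA := ∫ x in (0:ℝ)..1, fB p x * fA r x
  set iAB := ∫ x in (0:ℝ)..1, fA p x * fB r x
  set iBB := ∫ x in (0:ℝ)..1, fB p x * fB r x
  have AA' : |iAA - 4 / (p * r)| ≤ 2 / (r:ℝ)^2 := by
    have : p * iAA - 4 * (1 / (p:ℝ)) * (p * (1 / r)) = p * (iAA - 4 / (p * r)) := by field_simp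
    rw [this, abs_mul, abs_of_pos hp0] at AA
    have e : 2 * (p * (1 / (r:ℝ))) / r = p * (2 / (r:ℝ)^2) := by field_simp
    rw [e] at AA
    exact le_of_mul_le_mul_left AA hp0
  have BA' : |iBA - 4 / ((p:ℝ)^2 * r)| ≤ 2 / (r:ℝ)^2 := by
    convert BA using 1
    · congr 2; field_simp
    · field_simp
  have hm : mm p * mm r = 4 / (p * r) - 4 / ((p:ℝ)^2 * r) - (4 / p - 4 / (p:ℝ)^2) * (1 / (r:ℝ)^2) := by
    unfold mm; field_simp; ring
  have q1 : 0 ≤ 4 / (p:ℝ) - 4 / (p:ℝ)^2 := by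
    rw [sub_nonneg]; gcongr; nlinarith
  have q2 : 4 / (p:ℝ) - 4 / (p:ℝ)^2 ≤ 4 := by
    have : 4 / (p:ℝ) ≤ 4 := by rw [div_le_iff₀ hp0]; linarith
    have : 0 ≤ 4 / (p:ℝ)^2 := by positivity
    linarith
  have q3 : 0 ≤ 1 / (r:ℝ)^2 := by positivity
  rw [hm]
  have z2 : 2 / (r:ℝ)^2 = 2 * (1 / (r:ℝ)^2) := by ring
  have z16 : 16 / (r:ℝ)^2 = 16 * (1 / (r:ℝ)^2) := by ring
  rw [z16]
  rw [abs_le] at *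
  have := mul_nonneg q1 q3
  have := mul_le_mul_of_nonneg_right q2 q3
  constructor <;> linarith [AA'.1, AA'.2, BA'.1, BA'.2, AB.1, AB.2, BB.1, BB.2]

lemma cov_self (hp : 2 ≤ p) :
    |(∫ x in (0:ℝ)..1, gg p x * gg p x) - mm p| ≤ 16 / (p:ℝ)^2 := by
  have hp' : (2:ℝ) ≤ p := by exact_mod_cast hp
  have hp0 : (0:ℝ) < p := by linarith
  rw [int_gg hp hp]
  have AB := mulB_bound hp (niceA hp) (fun x => VV_nonneg (pos1 hp) _) (fun x => VV_le_one (half1 hp) _)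
  have eAA : ∫ x in (0:ℝ)..1, fA p x * fA p x = 2 / p := by
    rw [← intA hp]
    exact intervalIntegral.integral_congr fun x _ => VV_sq (pos1 hp) (half1 hp) _
  have eBB : ∫ x in (0:ℝ)..1, fB p x * fB p x = 2 / (p:ℝ)^2 := by
    rw [← intB]
    exact intervalIntegral.integral_congr fun x _ => VV_sq (pos2 hp) (half2 hp) _
  have eBA : ∫ x in (0:ℝ)..1, fB p x * fA p x = ∫ x in (0:ℝ)..1, fA p x * fB p x :=
    intervalIntegral.integral_congr fun x _ => mul_comm _ _
  rw [eAA, eBB, eBA]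
  set i := ∫ x in (0:ℝ)..1, fA p x * fB p x
  have m0 : 0 ≤ mm p := by
    unfold mm; rw [sub_nonneg]; gcongr; nlinarith
  have m1 : mm p ≤ 2 / p := by
    unfold mm
    have : 0 ≤ 2 / (p:ℝ)^2 := by positivity
    linarith
  have m2 : mm p * mm p ≤ 4 * (1 / (p:ℝ)^2) := by
    calc mm p * mm p ≤ (2 / p) * (2 / p) := by gcongr
      _ = _ := by field_simp; norm_num
  have m3 := mul_nonneg m0 m0
  have q3 : 0 ≤ 1 / (p:ℝ)^2 := by positivity
  have z2 : 2 / (p:ℝ)^2 = 2 * (1 / (p:ℝ)^2) := by ring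
  have z16 : 16 / (p:ℝ)^2 = 16 * (1 / (p:ℝ)^2) := by ring
  have hm : mm p = 2 / p - 2 * (1 / (p:ℝ)^2) := by unfold mm; ring
  rw [z16, abs_le]
  constructor <;> linarith [AB.1, AB.2]

end

lemma cov_bound {p r : ℕ} (hp : p.Prime) (hr : r.Prime) :
    |(∫ x in (0:ℝ)..1, gg p x * gg r x) - (if p = r then mm p else 0)| ≤
      (if p ≤ r then 16 / (r:ℝ)^2 else 0) + (if r ≤ p then 16 / (p:ℝ)^2 else 0) := by
  rcases lt_trichotomy p r with h | rfl | h
  · rw [if_neg h.ne, if_pos h.le, if_neg (by omega), sub_zero, add_zero]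
    exact cov_lt hp.two_le hr.two_le ((Nat.coprime_primes hp hr).2 h.ne)
  · simp only [if_true, le_refl]
    have := cov_self hp.two_le
    have : 0 ≤ 16 / (p:ℝ)^2 := by positivity
    linarith
  · rw [if_neg h.ne', if_neg (by omega), if_pos h.le, sub_zero, zero_add]
    simp_rw [mul_comm (gg p _)]
    exact cov_lt hr.two_le hp.two_le ((Nat.coprime_primes hr hp).2 h.ne)

lemma count_p {p : ℕ} (hp : p.Prime) (α : ℝ) :
    (((Finset.Ioo ⌊p * α - 1 / p⌋ ⌈p * α + 1 / p⌉).filter (fun a : ℤ => ¬ (p:ℤ) ∣ a)).card : ℝ)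
      = fA p α - fB p α := by
  have hp0 : (0:ℝ) < p := by exact_mod_cast hp.pos
  have h1 := Finset.card_filter_add_card_filter_not (s := Finset.Ioo ⌊p * α - 1 / p⌋ ⌈p * α + 1 / p⌉)
    (fun a : ℤ => (p:ℤ) ∣ a)
  have h2 : (Finset.Ioo ⌊p * α - 1 / p⌋ ⌈p * α + 1 / p⌉).filter (fun a : ℤ => (p:ℤ) ∣ a)
      = (Finset.Ioo ⌊α - 1 / (p:ℝ)^2⌋ ⌈α + 1 / (p:ℝ)^2⌉).image (fun c : ℤ => (p:ℤ) * c) := by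
    have key : ∀ c : ℤ, |p * α - ((p * c : ℤ) : ℝ)| < 1 / p ↔ |α - c| < 1 / (p:ℝ)^2 := by
      intro c
      push_cast
      rw [← mul_sub, abs_mul, abs_of_pos hp0, ← lt_div_iff₀' hp0, div_div, pow_two]
    ext a
    rw [Finset.mem_filter, Finset.mem_image, mem_Ioo_VV]
    constructor
    · rintro ⟨h, c, rfl⟩
      exact ⟨c, (mem_Ioo_VV _ _ _).2 ((key c).1 h), rfl⟩
    · rintro ⟨c, h, rfl⟩
      exact ⟨(key c).2 ((mem_Ioo_VV _ _ _).1 h), dvd_mul_right _ _⟩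
  rw [h2, Finset.card_image_of_injective] at h1
  · have h3 := card_VV (pos1 hp.two_le) (p * α)
    have h4 := card_VV (pos2 hp.two_le) α
    unfold fA fB
    rw [← h3, ← h4, ← h1]
    push_cast; ring
  · intro a b hab
    have : (p:ℤ) ≠ 0 := by exact_mod_cast hp.ne_zero
    exact mul_left_cancel₀ this hab

lemma Ncount_eq (α : ℝ) (Q : ℕ) :
    (Ncount (fun q => if q.Prime then 1 / (q : ℝ) else 0) α Q : ℝ)
      = ∑ p ∈ (Finset.Icc 1 Q).filter Nat.Prime, (fA p α - fB p α) := by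
  classical
  set P := (Finset.Icc 1 Q).filter Nat.Prime with hP
  let G : ℕ → Finset ℤ := fun p =>
    (Finset.Ioo ⌊p * α - 1 / p⌋ ⌈p * α + 1 / p⌉).filter (fun a : ℤ => ¬ (p:ℤ) ∣ a)
  let F : (Σ _ : ℕ, ℤ) → ℤ × ℕ := fun x => (x.2, x.1)
  have hF : Function.Injective F := by
    rintro ⟨a, b⟩ ⟨c, d⟩ h
    simp only [F, Prod.mk.injEq] at h
    obtain ⟨rfl, rfl⟩ := h; rfl
  have hS : {x : ℤ × ℕ | 1 ≤ x.2 ∧ x.2 ≤ Q ∧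
    |α - (x.1 : ℝ) / (x.2 : ℝ)| < (fun q : ℕ => if q.Prime then 1 / (q : ℝ) else 0) x.2 / (x.2 : ℝ)
      ∧ Int.gcd x.1 (x.2 : ℤ) = 1} = (((P.sigma G).image F : Finset (ℤ × ℕ)) : Set (ℤ × ℕ)) := by
    have key : ∀ (a : ℤ) (q : ℕ), q.Prime → (|α - (a:ℝ) / q| < 1 / (q:ℝ) / q ↔
        |q * α - a| < 1 / (q:ℝ)) := by
      intro a q hq
      have hq0 : (0:ℝ) < q := by exact_mod_cast hq.pos
      rw [lt_div_iff₀ hq0, ← abs_of_pos hq0, ← abs_mul, abs_of_pos hq0, sub_mul,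
        div_mul_cancel₀ _ hq0.ne', mul_comm α]
    have kg : ∀ (a : ℤ) (q : ℕ), q.Prime → (Int.gcd a q = 1 ↔ ¬ (q:ℤ) ∣ a) := by
      intro a q hq
      rw [Int.gcd_comm, ← Int.isCoprime_iff_gcd_eq_one,
        (Nat.prime_iff_prime_int.1 hq).coprime_iff_not_dvd]
    ext ⟨a, q⟩
    simp only [Set.mem_ofPred_eq, Finset.coe_image, Set.mem_image, Finset.mem_coe]
    constructor
    · rintro ⟨h1, h2, h3, h4⟩
      by_cases hq : q.Prime
      · rw [if_pos hq, key a q hq] at h3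
        rw [kg a q hq] at h4
        refine ⟨⟨q, a⟩, ?_, rfl⟩
        rw [Finset.mem_sigma]
        refine ⟨by simp [hP, h1, h2, hq], ?_⟩
        simp only [G, Finset.mem_filter]
        exact ⟨(mem_Ioo_VV _ _ _).2 h3, h4⟩
      · rw [if_neg hq, zero_div] at h3
        exact absurd h3 (not_lt.2 (abs_nonneg _))
    · rintro ⟨⟨q', a'⟩, h, e⟩
      simp only [F, Prod.mk.injEq] at e
      obtain ⟨rfl, rfl⟩ := e
      rw [Finset.mem_sigma] at h
      obtain ⟨h1, h2⟩ := h
      simp only [hP, Finset.mem_filter, Finset.mem_Icc] at h1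
      simp only [G, Finset.mem_filter] at h2
      refine ⟨h1.1.1, h1.1.2, ?_, (kg _ _ h1.2).2 h2.2⟩
      rw [if_pos h1.2, key _ _ h1.2]
      exact (mem_Ioo_VV _ _ _).1 h2.1
  unfold Ncount
  rw [hS, Nat.card_coe_set_eq, Set.ncard_coe_finset, Finset.card_image_of_injective _ hF,
    Finset.card_sigma]
  push_cast
  refine Finset.sum_congr rfl fun p hp => ?_
  exact count_p (Finset.mem_filter.1 hp).2 α

lemma Psi_eq (Q : ℕ) : Psi (fun q => if q.Prime then 1 / (q : ℝ) else 0) Q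
      = ∑ p ∈ (Finset.Icc 1 Q).filter Nat.Prime, mm p := by
  unfold Psi
  rw [Finset.sum_filter, Finset.mul_sum]
  refine Finset.sum_congr rfl fun p hp => ?_
  by_cases h : p.Prime
  · simp only [if_pos h]
    have hp0 : (0:ℝ) < p := by exact_mod_cast h.pos
    rw [Nat.totient_prime h, Nat.cast_sub h.one_le]
    unfold mm
    push_cast
    field_simp
  · simp [h]

/-- For `ψ(q) = 1_{q prime}/q`, the variance `∫₀¹ (N(α;Q) − Ψ(Q))² dα` equals
`Ψ(Q) + O(1)`, with an absolute implied constant. -/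
theorem variance_prime_example :
    ∃ C : ℝ, 0 < C ∧ ∀ Q : ℕ, 1 ≤ Q →
      |(∫ α in (0 : ℝ)..1,
          ((Ncount (fun q => if q.Prime then 1 / (q : ℝ) else 0) α Q : ℝ) -
            Psi (fun q => if q.Prime then 1 / (q : ℝ) else 0) Q) ^ 2) -
        Psi (fun q => if q.Prime then 1 / (q : ℝ) else 0) Q| ≤ C := by
  obtain ⟨K, hK0, hK⟩ := prime_sum_bdd
  refine ⟨32 * K + 1, by linarith, fun Q _ => ?_⟩
  simp_rw [Ncount_eq, Psi_eq, ← Finset.sum_sub_distrib]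
  set P := (Finset.Icc 1 Q).filter Nat.Prime with hP
  have hprime : ∀ p ∈ P, p.Prime := fun p hp => (Finset.mem_filter.1 hp).2
  have hint : ∫ α in (0:ℝ)..1, (∑ p ∈ P, (fA p α - fB p α - mm p)) ^ 2
      = ∑ p ∈ P, ∑ r ∈ P, ∫ α in (0:ℝ)..1, gg p α * gg r α := by
    have hn : ∀ p ∈ P, ∀ r ∈ P, IntervalIntegrable (fun α => gg p α * gg r α) volume 0 1 :=
      fun p hp r hr =>
        ((niceG (hprime p hp).two_le).mul (niceG (hprime r hr).two_le)).ii _ _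
    simp_rw [pow_two, Finset.sum_mul_sum]
    change ∫ α in (0:ℝ)..1, ∑ p ∈ P, ∑ r ∈ P, gg p α * gg r α = _
    rw [intervalIntegral.integral_finsetSum]
    · refine Finset.sum_congr rfl fun p hp => ?_
      rw [intervalIntegral.integral_finsetSum]
      exact hn p hp
    · intro p hp
      have := IntervalIntegrable.sum P (hn p hp)
      simpa only [Finset.sum_fn] using this
  rw [hint]
  have hm : ∑ p ∈ P, mm p = ∑ p ∈ P, ∑ r ∈ P, (if p = r then mm p else 0) := by
    refine Finset.sum_congr rfl fun p hp => ?_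
    rw [Finset.sum_ite_eq, if_pos hp]
  rw [hm, ← Finset.sum_sub_distrib]
  simp_rw [← Finset.sum_sub_distrib]
  have hcount : ∀ r ∈ P, ∑ p ∈ P, (if p ≤ r then 16 / (r:ℝ)^2 else 0)
      ≤ 16 * ((Nat.primeCounting r : ℝ) / (r:ℝ)^2) := by
    intro r _
    rw [← Finset.sum_filter, Finset.sum_const, nsmul_eq_mul]
    have : ((P.filter (fun p => p ≤ r)).card : ℝ) ≤ Nat.primeCounting r := by
      rw [← Nat.primesLE_card_eq_primeCounting]
      norm_cast
      apply Finset.card_le_card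
      intro p hp
      rw [Finset.mem_filter] at hp
      exact Nat.mem_primesLE.2 ⟨hp.2, hprime p hp.1⟩
    calc _ ≤ (Nat.primeCounting r : ℝ) * (16 / (r:ℝ)^2) := by gcongr
      _ = _ := by ring
  have hS : ∑ r ∈ P, ∑ p ∈ P, (if p ≤ r then 16 / (r:ℝ)^2 else 0) ≤ 16 * K := by
    refine (Finset.sum_le_sum hcount).trans ?_
    rw [← Finset.mul_sum]
    have := hK Q
    linarith
  calc _ ≤ ∑ p ∈ P, ∑ r ∈ P, |(∫ x in (0:ℝ)..1, gg p x * gg r x) - (if p = r then mm p else 0)| :=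
        (Finset.abs_sum_le_sum_abs _ _).trans
          (Finset.sum_le_sum fun p _ => Finset.abs_sum_le_sum_abs _ _)
    _ ≤ ∑ p ∈ P, ∑ r ∈ P, ((if p ≤ r then 16 / (r:ℝ)^2 else 0) + (if r ≤ p then 16 / (p:ℝ)^2 else 0)) :=
        Finset.sum_le_sum fun p hp => Finset.sum_le_sum fun r hr =>
          cov_bound (hprime p hp) (hprime r hr)
    _ = (∑ p ∈ P, ∑ r ∈ P, (if p ≤ r then 16 / (r:ℝ)^2 else 0))
        + ∑ p ∈ P, ∑ r ∈ P, (if r ≤ p then 16 / (p:ℝ)^2 else 0) := by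
        simp_rw [Finset.sum_add_distrib]
    _ ≤ 32 * K + 1 := by
        rw [Finset.sum_comm]
        linarith
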